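/- Let p be a prime and A a reduced 𝔽_p-algebra (for instance a regular 𝔽_p-algebra), f ∈ A, and A_f = A[1/f]. For m ≥ 2 and n ∈ ℤ let W_m^{(n)}(A,f) := [f]^{-n}·ι(W_m(A)) ⊆ W_m(A_f), and let F^{m-1}: W_m(A_f) → W_1(A_f) = A_f denote the (m−1)-fold iterated Witt vector Frobenius. Then the kernel of F^{m-1} restricted to W_m^{(n)}(A,f) equals V(W_{m-1}^{(pn)}(A,f)), the image of W_{m-1}^{(pn)}(A,f) under the Verschiebung V: W_{m-1}(A_f) → W_m(A_f). -/

import Mathlib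

noncomputable section

open TruncatedWittVector

variable (p : ℕ) [hp : Fact p.Prime]

/-- The coordinatewise map of truncated Witt vectors along a ring homomorphism. -/
def twvMap {B C : Type*} [CommRing B] [CommRing C] (φ : B →+* C) {m : ℕ}
    (x : TruncatedWittVector p m B) : TruncatedWittVector p m C :=
  TruncatedWittVector.mk p fun i => φ (x.coeff i)

/-- The Verschiebung `V : W_m(B) → W_{m+1}(B)`, shifting coordinates by one. -/
def twvV {B : Type*} [CommRing B] {m : ℕ} (x : TruncatedWittVector p m B) :
    TruncatedWittVector p (m + 1) B :=
  TruncatedWittVector.mk p (Fin.cases 0 fun i => x.coeff i)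

/-- The Frobenius `F : W_{m+1}(B) → W_m(B)` of a ring `B` of characteristic `p`,
induced coordinatewise by the `p`-th power map composed with truncation. -/
def twvF {B : Type*} [CommRing B] {m : ℕ} (x : TruncatedWittVector p (m + 1) B) :
    TruncatedWittVector p m B :=
  TruncatedWittVector.mk p fun i => (x.coeff i.castSucc) ^ p

/-- The restriction (truncation) `R : W_{m+1}(B) → W_m(B)`. -/
def twvR {B : Type*} [CommRing B] {m : ℕ} :
    TruncatedWittVector p (m + 1) B →+* TruncatedWittVector p m B :=
  TruncatedWittVector.truncate (Nat.le_succ m)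

/-- The `i`-fold iterated Verschiebung `V^i : W_a(B) → W_{a+i}(B)`. -/
def twvViter {B : Type*} [CommRing B] : (i : ℕ) → {a : ℕ} →
    TruncatedWittVector p a B → TruncatedWittVector p (a + i) B
  | 0, _, x => x
  | i + 1, _, x => twvV p (twvViter i x)

/-- The `j`-fold iterated Frobenius `F^j : W_{j+1}(B) → W_1(B)`. -/
def twvFpow {B : Type*} [CommRing B] : {j : ℕ} →
    TruncatedWittVector p (j + 1) B → TruncatedWittVector p 1 B
  | 0, x => x
  | _ + 1, x => twvFpow (twvF p x)

/-- The Teichmüller representative `[·] : B →* W_m(B)`. -/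
def twvTeichmuller {B : Type*} [CommRing B] (m : ℕ) : B →* TruncatedWittVector p m B :=
  (WittVector.truncate m).toMonoidHom.comp (WittVector.teichmuller p)

variable (A : Type*) [CommRing A] (f : A)

/-- `f` becomes a unit in the localization `A_f = A[1/f]`. -/
def awayUnit : (Localization.Away f)ˣ :=
  (IsLocalization.Away.algebraMap_isUnit (S := Localization.Away f) f).unit

/-- The Teichmüller representative `[f]` of `f`, as a unit of `W_m(A_f)`. -/
def twvTeichUnit (m : ℕ) : (TruncatedWittVector p m (Localization.Away f))ˣ :=
  Units.map (twvTeichmuller p (B := Localization.Away f) m) (awayUnit A f)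

/-- The canonical (coordinatewise) map `ι : W_m(A) → W_m(A_f)`. -/
def twvLoc (m : ℕ) (x : TruncatedWittVector p m A) :
    TruncatedWittVector p m (Localization.Away f) :=
  twvMap p (algebraMap A (Localization.Away f)) x

/-- The twisted subset `W_m^{(n)}(A,f) = [f]^{-n} · ι(W_m(A)) ⊆ W_m(A_f)`. -/
def twistedWitt (m : ℕ) (n : ℤ) : Set (TruncatedWittVector p m (Localization.Away f)) :=
  { y | ∃ x : TruncatedWittVector p m A,
      y = (↑(twvTeichUnit p A f m ^ (-n)) : TruncatedWittVector p m (Localization.Away f))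
            * twvLoc p A f m x }

end

namespace WittVector

variable {p : ℕ} [hp : Fact p.Prime]

/-- The coordinates of the product of a Teichmüller representative and a Witt vector, when
`p` is invertible. -/
theorem teichmuller_mul_eq_mk_of_invertible {R : Type*} [CommRing R] [Invertible (p : R)]
    (r : R) (x : WittVector p R) :
    teichmuller p r * x = WittVector.mk p fun i => r ^ p ^ i * x.coeff i := by
  apply (ghostMap.bijective_of_invertible p R).1
  rw [map_mul]
  ext1 n
  simp only [Pi.mul_apply, ghostMap_apply, ghostComponent_teichmuller]
  simp only [ghostComponent_apply, aeval_wittPolynomial, Finset.mul_sum, coeff_mk]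
  refine Finset.sum_congr rfl fun i hi => ?_
  have hin : i + (n - i) = n := Nat.add_sub_of_le (Nat.lt_succ_iff.mp (Finset.mem_range.mp hi))
  rw [mul_pow, ← pow_mul, ← pow_add, hin]
  ring

/-- A ring homomorphism is compatible with rescaling the coordinates of a Witt vector. -/
theorem map_mk_pow_mul_coeff {R S : Type*} [CommRing R] [CommRing S] (φ : R →+* S) (r : R)
    (x : WittVector p R) :
    map φ (WittVector.mk p fun i => r ^ p ^ i * x.coeff i) =
      WittVector.mk p fun i => φ r ^ p ^ i * (map φ x).coeff i := by
  ext i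
  simp [map_coeff]

/-- Multiplication by a Teichmüller representative rescales the `i`-th coordinate by its
`p ^ i`-th power. -/
theorem teichmuller_mul_coeff {R : Type*} [CommRing R] (r : R) (x : WittVector p R) (i : ℕ) :
    (teichmuller p r * x).coeff i = r ^ p ^ i * x.coeff i := by
  suffices h : teichmuller p r * x = WittVector.mk p fun i => r ^ p ^ i * x.coeff i by
    rw [h, coeff_mk]
  have hsurj := MvPolynomial.counit_surjective R
  obtain ⟨r, rfl⟩ := hsurj r
  obtain ⟨x, rfl⟩ := map_surjective (p := p) _ hsurj x
  rw [← map_teichmuller, ← map_mul, ← map_mk_pow_mul_coeff]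
  congr 1
  refine map_injective (MvPolynomial.map (Int.castRingHom ℚ))
    (MvPolynomial.map_injective _ Int.cast_injective) ?_
  rw [map_mul, map_teichmuller, map_mk_pow_mul_coeff, teichmuller_mul_eq_mk_of_invertible]

end WittVector

section TruncatedCoordinates

variable {p : ℕ}

theorem coeff_twvFpow {B : Type*} [CommRing B] {j : ℕ} (x : TruncatedWittVector p (j + 1) B) :
    (twvFpow p x).coeff 0 = x.coeff 0 ^ p ^ j := by
  induction j with
  | zero => simp [twvFpow]
  | succ j ih =>
    rw [twvFpow, ih, twvF, TruncatedWittVector.coeff_mk, ← pow_mul, ← pow_succ', Fin.castSucc_zero]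

@[simp]
theorem coeff_twvV_zero {B : Type*} [CommRing B] {m : ℕ} (x : TruncatedWittVector p m B) :
    (twvV p x).coeff 0 = 0 := by
  simp [twvV]

@[simp]
theorem coeff_twvV_succ {B : Type*} [CommRing B] {m : ℕ} (x : TruncatedWittVector p m B)
    (i : Fin m) : (twvV p x).coeff i.succ = x.coeff i := by
  simp [twvV]

theorem exists_twvV_eq {B : Type*} [CommRing B] {m : ℕ} {x : TruncatedWittVector p (m + 1) B}
    (h : x.coeff 0 = 0) : ∃ z, twvV p z = x := by
  refine ⟨TruncatedWittVector.mk p fun i => x.coeff i.succ, ?_⟩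
  ext i
  cases i using Fin.cases <;> simp [h]

variable [hp : Fact p.Prime]

theorem coeff_twvTeichmuller_mul {B : Type*} [CommRing B] {m : ℕ} (b : B)
    (x : TruncatedWittVector p m B) (i : Fin m) :
    (twvTeichmuller p m b * x).coeff i = b ^ p ^ (i : ℕ) * x.coeff i := by
  obtain ⟨x, rfl⟩ := WittVector.truncate_surjective p m B x
  change (WittVector.truncate m (WittVector.teichmuller p b) * _).coeff i = _
  rw [← map_mul, WittVector.coeff_truncate, WittVector.teichmuller_mul_coeff,
    WittVector.coeff_truncate]

theorem twvFpow_eq_zero_iff {B : Type*} [CommRing B] [IsReduced B] {j : ℕ}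
    (x : TruncatedWittVector p (j + 1) B) : twvFpow p x = 0 ↔ x.coeff 0 = 0 := by
  rw [← pow_eq_zero_iff (a := x.coeff 0) (pow_ne_zero j hp.out.ne_zero), ← coeff_twvFpow]
  refine ⟨fun h => by rw [h, TruncatedWittVector.coeff_zero], fun h => ?_⟩
  ext i
  rw [Subsingleton.elim i 0, h, TruncatedWittVector.coeff_zero]

/-- Membership in the twisted Witt vectors is a condition on each coordinate. -/
theorem mem_twistedWitt_iff {A : Type*} [CommRing A] {f : A} {m : ℕ} {n : ℤ}
    {y : TruncatedWittVector p m (Localization.Away f)} :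
    y ∈ twistedWitt p A f m n ↔ ∀ i : Fin m, ∃ a : A,
      y.coeff i = (↑(awayUnit A f ^ (-n)) : Localization.Away f) ^ p ^ (i : ℕ) *
        algebraMap A (Localization.Away f) a := by
  have hcoeff (x : TruncatedWittVector p m A) (i : Fin m) :
      ((↑(twvTeichUnit p A f m ^ (-n)) : TruncatedWittVector p m (Localization.Away f)) *
        twvLoc p A f m x).coeff i =
      (↑(awayUnit A f ^ (-n)) : Localization.Away f) ^ p ^ (i : ℕ) *
        algebraMap A (Localization.Away f) (x.coeff i) := by
    rw [twvTeichUnit, ← map_zpow, Units.coe_map, coeff_twvTeichmuller_mul,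
      twvLoc, twvMap, TruncatedWittVector.coeff_mk]
  constructor
  · rintro ⟨x, rfl⟩ i
    exact ⟨x.coeff i, hcoeff x i⟩
  · intro h
    choose a ha using h
    refine ⟨TruncatedWittVector.mk p a, ?_⟩
    ext i
    rw [hcoeff, TruncatedWittVector.coeff_mk, ha]

/-- `V z` lies in the `n`-twisted Witt vectors exactly when `z` lies in the `p * n`-twisted
ones. -/
theorem twvV_mem_twistedWitt_iff {A : Type*} [CommRing A] {f : A} {m : ℕ} {n : ℤ}
    {z : TruncatedWittVector p m (Localization.Away f)} :
    twvV p z ∈ twistedWitt p A f (m + 1) n ↔ z ∈ twistedWitt p A f m ((p : ℤ) * n) := by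
  have hpow (i : ℕ) : (↑(awayUnit A f ^ (-((p : ℤ) * n))) : Localization.Away f) ^ p ^ i =
      (↑(awayUnit A f ^ (-n)) : Localization.Away f) ^ p ^ (i + 1) := by
    rw [pow_succ', pow_mul, ← Units.val_pow_eq_pow_val _ p, ← zpow_natCast, ← zpow_mul]
    congr 4
    ring
  simp only [mem_twistedWitt_iff, Fin.forall_fin_succ, coeff_twvV_zero, coeff_twvV_succ,
    Fin.val_succ, hpow]
  exact and_iff_right ⟨0, by simp⟩

end TruncatedCoordinates

/-- Let `p` be a prime, `A` a reduced `𝔽_p`-algebra, `f ∈ A`, and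
`A_f = A[1/f]`.  For `m ≥ 2` (below `m = m' + 2`) and `n ∈ ℤ` let
`W_m^{(n)}(A,f) := [f]^{-n}·ι(W_m(A)) ⊆ W_m(A_f)`, and let `F^{m-1} : W_m(A_f) → W_1(A_f)`
denote the `(m-1)`-fold iterated Witt vector Frobenius.  Then the kernel of `F^{m-1}` restricted
to `W_m^{(n)}(A,f)` equals `V(W_{m-1}^{(pn)}(A,f))`, the image of `W_{m-1}^{(pn)}(A,f)` under
the Verschiebung `V : W_{m-1}(A_f) → W_m(A_f)`. -/
theorem twistedWitt_ker_iterated_frobenius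
    (p : ℕ) [Fact p.Prime] (A : Type*) [CommRing A] [Algebra (ZMod p) A] [IsReduced A] (f : A)
    (m' : ℕ) (n : ℤ) :
    { x ∈ twistedWitt p A f (m' + 2) n | twvFpow p x = 0 } =
      twvV p '' (twistedWitt p A f (m' + 1) ((p : ℤ) * n)) := by
  ext x
  simp only [Set.mem_ofPred_eq, Set.mem_image, twvFpow_eq_zero_iff]
  constructor
  · rintro ⟨hx, h0⟩
    obtain ⟨z, rfl⟩ := exists_twvV_eq h0
    exact ⟨z, twvV_mem_twistedWitt_iff.mp hx, rfl⟩
  · rintro ⟨z, hz, rfl⟩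
    exact ⟨twvV_mem_twistedWitt_iff.mpr hz, coeff_twvV_zero z⟩
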